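/- Let A ⊆ A_m^n be a strongly transitive arrangement, let L ∈ L(A), and let blocks(L) = {B_1,…,B_d}. Let ℓ ∈ [d] and let δ^ℓ := max(δ_L(j) : j ∈ B_ℓ). Then for every k ∈ [d] with k ≠ ℓ and every t ∈ [0; δ^ℓ], the hyperplane {y ∈ ℝ^d : y_k − y_ℓ = t} belongs to Ã_L, unless |B_k| = |B_ℓ| = 1. -/

import Mathlib

open scoped BigOperators Classical

namespace Braid

/-- The hyperplane `{x ∈ ℝ^n | x i - x j = s}`. -/
def hyp (n : ℕ) (i j : Fin n) (s : ℝ) : Set (Fin n → ℝ) := {x | x i - x j = s}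

/-- The arrangement `A_S^n`, as a set of hyperplanes. -/
def arrS (S : Set ℤ) (n : ℕ) : Set (Set (Fin n → ℝ)) :=
  {H | ∃ i j : Fin n, ∃ s : ℤ, i < j ∧ s ∈ S ∧ H = hyp n i j (s : ℝ)}

/-- The `m`-Catalan arrangement `A_m^n = A_{[-m;m]}^n`. -/
def catArr (m n : ℕ) : Set (Set (Fin n → ℝ)) := arrS {s : ℤ | s.natAbs ≤ m} n

/-- `(i,j,s) ∈ Tr_m^n`. -/
def TrIdx (m n : ℕ) (i j : Fin n) (s : ℕ) : Prop := s ≤ m ∧ i ≠ j ∧ (0 < s ∨ j < i)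

/-- `(i,j,s) ∈ Tr_m^n(A)`. -/
def TrIdxA (m n : ℕ) (A : Set (Set (Fin n → ℝ))) (i j : Fin n) (s : ℕ) : Prop :=
  TrIdx m n i j s ∧ hyp n i j (s : ℝ) ∈ A

/-- A transitive arrangement `A ⊆ A_m^n`. -/
def IsTransitive (m n : ℕ) (A : Set (Set (Fin n → ℝ))) : Prop :=
  ∀ i j k : Fin n, i ≠ j → j ≠ k → i ≠ k → ∀ s t : ℕ,
    TrIdx m n i j s → TrIdx m n j k t →
    hyp n i j (s : ℝ) ∉ A → hyp n j k (t : ℝ) ∉ A → hyp n i k ((s : ℝ) + (t : ℝ)) ∉ A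

/-- A strongly transitive arrangement. -/
def IsStronglyTransitive (n : ℕ) (A : Set (Set (Fin n → ℝ))) : Prop :=
  ∀ i j k : Fin n, i ≠ j → j ≠ k → i ≠ k → ∀ s t : ℕ,
    hyp n i j (s : ℝ) ∉ A → hyp n j k (t : ℝ) ∉ A → hyp n i k ((s : ℝ) + (t : ℝ)) ∉ A

/-- An `(m,n)`-tree: a rooted `(m+1)`-ary tree with `n` nodes labeled by `Fin n`
(leaves unlabeled), encoded by the root-to-node lists of child indices. -/
structure Tree (m n : ℕ) where
  path : Fin n → List ℕ
  entry_le : ∀ v : Fin n, ∀ s ∈ path v, s ≤ m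
  inj : Function.Injective path
  parent_closed : ∀ v : Fin n, path v ≠ [] → ∃ w : Fin n, path w = (path v).dropLast

namespace Tree

variable {m n : ℕ}

/-- The drift of a node. -/
def drift (T : Tree m n) (v : Fin n) : ℕ := (T.path v).sum

/-- `i = s`-child`(j)`. -/
def IsChild (T : Tree m n) (i j : Fin n) (s : ℕ) : Prop := T.path i = T.path j ++ [s]

/-- The `s`-child slot of node `j` is occupied by a node (not a leaf). -/
def SlotNode (T : Tree m n) (j : Fin n) (s : ℕ) : Prop := ∃ i, T.IsChild i j s

/-- `i = s`-cadet`(j)`. -/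
def IsCadet (T : Tree m n) (i j : Fin n) (s : ℕ) : Prop :=
  T.IsChild i j s ∧ ∀ t : ℕ, s < t → t ≤ m → ¬ T.SlotNode j t

end Tree

/-- The order `≺_T` on vertices of a tree, expressed on root-to-vertex paths:
`v ≺_T w` iff `drift(v) < drift(w)`, or the drifts are equal and there is `c ≤ k`
(`k` the length of the path of `v`) with the first `c` entries of both paths equal and
(`c = k` or the entry of the path of `v` at position `c+1` is larger than that of `w`). -/
def vlt (p q : List ℕ) : Prop :=
  p.sum < q.sum ∨
    (p.sum = q.sum ∧ ∃ c ≤ p.length, p.take c = q.take c ∧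
      (c = p.length ∨ ∃ (h1 : c < p.length) (h2 : c < q.length), q.get ⟨c, h2⟩ < p.get ⟨c, h1⟩))

/-- `p ≽_T q`. -/
def vge (p q : List ℕ) : Prop := vlt q p ∨ p = q

/-- A valid marking: `μ` is the set of (lower endpoints of) marked edges; each marked
edge is a cadet edge, and marked `0`-cadet edges `{j, 0cadet(j)}` satisfy `j < 0cadet(j)`. -/
def IsMarking {m n : ℕ} (T : Tree m n) (μ : Set (Fin n)) : Prop :=
  ∀ i ∈ μ, ∃ j s, T.IsCadet i j s ∧ (s = 0 → (j : ℕ) < (i : ℕ))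

/-- The relation `i ∼_μ j`: all edges on the tree path between `i` and `j` are marked. -/
def simMu {m n : ℕ} (T : Tree m n) (μ : Set (Fin n)) : Fin n → Fin n → Prop :=
  Relation.ReflTransGen (fun a b =>
    (a ∈ μ ∧ ∃ s, T.IsChild a b s) ∨ (b ∈ μ ∧ ∃ s, T.IsChild b a s))

/-- The block containing node `i`. -/
def blockOf {m n : ℕ} (T : Tree m n) (μ : Set (Fin n)) (i : Fin n) : Set (Fin n) :=
  {j | simMu T μ i j}

/-- The set of blocks of a marked tree. -/
def blocksOf {m n : ℕ} (T : Tree m n) (μ : Set (Fin n)) : Set (Set (Fin n)) :=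
  {B | ∃ i, B = blockOf T μ i}

/-- The block `B` is `A`-connected. -/
def BlockConnected {m n : ℕ} (A : Set (Set (Fin n → ℝ))) (T : Tree m n)
    (B : Set (Fin n)) : Prop :=
  ∀ i ∈ B, ∀ j ∈ B, Relation.ReflTransGen
    (fun a b => a ∈ B ∧ b ∈ B ∧ hyp n a b ((T.drift a : ℝ) - (T.drift b : ℝ)) ∈ A) i j

/-- The marked tree `(T,μ)` is `A`-connected. -/
def AConnected {m n : ℕ} (A : Set (Set (Fin n → ℝ))) (T : Tree m n)
    (μ : Set (Fin n)) : Prop :=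
  ∀ B ∈ blocksOf T μ, BlockConnected A T B

/-- The `A`-cadet condition. -/
def CadetCond {m n : ℕ} (A : Set (Set (Fin n → ℝ))) (T : Tree m n)
    (μ : Set (Fin n)) : Prop :=
  ∀ i j s, T.IsCadet i j s → i ∉ μ →
    ((s = 0 ∧ (i : ℕ) < (j : ℕ)) ∨
      ∃ i' j', simMu T μ i i' ∧ simMu T μ j j' ∧
        hyp n i' j' ((T.drift i' : ℝ) - (T.drift j' : ℝ)) ∈ A)

/-- The set `ŌT_m^n` of all marked `(m,n)`-trees. -/
def OTall (m n : ℕ) : Set (Tree m n × Set (Fin n)) := {p | IsMarking p.1 p.2}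

/-- The set `ŌT_m^n(A)`. -/
def OTset (m n : ℕ) (A : Set (Set (Fin n → ℝ))) : Set (Tree m n × Set (Fin n)) :=
  {p | IsMarking p.1 p.2 ∧ AConnected A p.1 p.2 ∧ CadetCond A p.1 p.2}

/-- The set `T_m^n(A)` of (unmarked) trees. -/
def Tset (m n : ℕ) (A : Set (Set (Fin n → ℝ))) : Set (Tree m n) :=
  {T | ∀ i j s, TrIdx m n i j s → hyp n i j (s : ℝ) ∉ A → ¬ T.IsCadet i j s}

/-- The region `Φ_A(T)`. -/
def Phi (m n : ℕ) (A : Set (Set (Fin n → ℝ))) (T : Tree m n) : Set (Fin n → ℝ) :=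
  {x | ∀ i j : Fin n, ∀ s : ℕ, TrIdxA m n A i j s →
        (vlt (T.path i) (T.path j ++ [s]) → x i - x j < (s : ℝ)) ∧
        (vge (T.path i) (T.path j ++ [s]) → (s : ℝ) < x i - x j)}

/-- The polyhedron `Φ̄_A(T,μ)`. -/
def PhiBar (m n : ℕ) (A : Set (Set (Fin n → ℝ))) (T : Tree m n) (μ : Set (Fin n)) :
    Set (Fin n → ℝ) :=
  {x | (∀ i ∈ μ, ∀ j s, T.IsChild i j s → x i - x j = (s : ℝ)) ∧
       ∀ i j : Fin n, ∀ s : ℕ, TrIdxA m n A i j s → ¬ simMu T μ i j →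
         (vlt (T.path i) (T.path j ++ [s]) → x i - x j < (s : ℝ)) ∧
         (vge (T.path i) (T.path j ++ [s]) → (s : ℝ) < x i - x j)}

/-- `R` is a region of `A`: a connected component of the complement of the union of `A`. -/
def IsRegion (n : ℕ) (A : Set (Set (Fin n → ℝ))) (R : Set (Fin n → ℝ)) : Prop :=
  ∃ x ∈ (⋃₀ A)ᶜ, R = connectedComponentIn (⋃₀ A)ᶜ x

/-- `σ` is the hyperplane `H` itself or one of the two open half-spaces bounded by `H`. -/
def IsSideOf (n : ℕ) (σ H : Set (Fin n → ℝ)) : Prop :=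
  σ = H ∨ ∃ (i j : Fin n) (s : ℝ), H = hyp n i j s ∧
    (σ = {x | x i - x j < s} ∨ σ = {x | s < x i - x j})

/-- `F` is a face of the arrangement `A`. -/
def IsFace (n : ℕ) (A : Set (Set (Fin n → ℝ))) (F : Set (Fin n → ℝ)) : Prop :=
  F.Nonempty ∧ ∃ σ : Set (Fin n → ℝ) → Set (Fin n → ℝ),
    (∀ H ∈ A, IsSideOf n (σ H) H) ∧ F = ⋂ H ∈ A, σ H

/-- The dimension of (the affine hull of) a subset of `ℝ^n`. -/
noncomputable def faceDim (n : ℕ) (F : Set (Fin n → ℝ)) : ℕ :=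
  Module.finrank ℝ (affineSpan ℝ F).direction

/-- The intersection lattice `L(A)`: nonempty intersections of subfamilies of `A`
(including `ℝ^n` as the empty intersection). -/
def latt (n : ℕ) (A : Set (Set (Fin n → ℝ))) : Set (Set (Fin n → ℝ)) :=
  {L | L.Nonempty ∧ ∃ B ⊆ A, L = ⋂₀ B}

/-- `i ∼_L j`: `L` is contained in a hyperplane `{x_i - x_j = s}` for some `s ∈ ℤ`. -/
def simL (n : ℕ) (L : Set (Fin n → ℝ)) (i j : Fin n) : Prop :=
  ∃ s : ℤ, L ⊆ hyp n i j (s : ℝ)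

/-- The set `blocks(L)` of equivalence classes of `∼_L`. -/
def blocksL (n : ℕ) (L : Set (Fin n → ℝ)) : Set (Set (Fin n)) :=
  {C | ∃ i, C = {j | simL n L i j}}

/-- `i ≼_L j` (within a block of `L`): `x_i < x_j` on `L`, or `x_i = x_j` on `L`
and `i ≤ j`. -/
def precLE (n : ℕ) (L : Set (Fin n → ℝ)) (i j : Fin n) : Prop :=
  (∀ x ∈ L, x i < x j) ∨ ((∀ x ∈ L, x i = x j) ∧ i ≤ j)

/-- The arrangement `Ã_L ⊆ ℝ^d` (given the enumeration `B` of the blocks of `L` and the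
function `δ = δ_L`). -/
def Atilde (n d : ℕ) (A : Set (Set (Fin n → ℝ))) (B : Fin d → Set (Fin n))
    (δ : Fin n → ℕ) : Set (Set (Fin d → ℝ)) :=
  {H | ∃ k l : Fin d, k ≠ l ∧ ∃ i ∈ B k, ∃ j ∈ B l, ∃ s : ℤ,
    hyp n i j (s : ℝ) ∈ A ∧ H = hyp d k l ((s : ℝ) - (δ i : ℝ) + (δ j : ℝ))}
theorem hyp_swap (n : ℕ) (i j : Fin n) (s : ℝ) : hyp n i j s = hyp n j i (-s) := by
  ext x; simp only [hyp, Set.mem_ofPred_eq]; constructor <;> intro h <;> linarith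

theorem crossing (m n : ℕ) (A : Set (Set (Fin n → ℝ))) (hA : A ⊆ catArr m n)
    (L : Set (Fin n → ℝ)) (hL : L ∈ latt n A) (S : Set (Fin n)) (i j : Fin n)
    (hi : i ∈ S) (hj : j ∉ S) (hij : simL n L i j) :
    ∃ i' ∈ S, ∃ j' ∉ S, ∃ s : ℤ, hyp n i' j' (s : ℝ) ∈ A ∧ L ⊆ hyp n i' j' (s : ℝ) := by
  by_contra! hno
  obtain ⟨⟨x, hx⟩, F, hF, rfl⟩ := hL
  obtain ⟨s, hs⟩ := hij
  have hy : (fun v => x v + if v ∈ S then (1 : ℝ) else 0) ∈ ⋂₀ F := by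
    intro H hH
    obtain ⟨p, q, r, hpq, -, rfl⟩ := hA (hF hH)
    have hsub : ⋂₀ F ⊆ hyp n p q (r : ℝ) := Set.sInter_subset_of_mem hH
    have h1 : x p - x q = r := hsub hx
    by_cases hp : p ∈ S <;> by_cases hq : q ∈ S
    · simp [hyp, hp, hq, h1]
    · exact absurd hsub (hno p hp q hq r (hF hH))
    · have e : hyp n p q (r : ℝ) = hyp n q p ((-r : ℤ) : ℝ) := by
        rw [hyp_swap]; push_cast; rfl
      have hA' := hF hH
      rw [e] at hsub hA'
      exact absurd hsub (hno q hq p hp (-r) hA')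
    · simp [hyp, hp, hq, h1]
  have h1 : x i - x j = s := hs hx
  have h2 := hs hy
  simp [hyp, hi, hj] at h2
  linarith

/-- Lemma 6.3. Let `A ⊆ A_m^n` be strongly transitive, `L ∈ L(A)` with
blocks `B_1,…,B_d`, `l ∈ [d]` and `δ^l = max(δ_L(j) : j ∈ B_l)`. Then for all `k ≠ l` and
all `t ∈ [0; δ^l]`, the hyperplane `{y_k - y_l = t}` belongs to `Ã_L`, unless
`|B_k| = |B_l| = 1`. -/
theorem cadet_condition_simple (m n : ℕ) (hm : 0 < m) (hn : 0 < n)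
    (A : Set (Set (Fin n → ℝ))) (hA : A ⊆ catArr m n)
    (hst : IsStronglyTransitive n A)
    (L : Set (Fin n → ℝ)) (hL : L ∈ latt n A)
    (d : ℕ) (hd : faceDim n L = d)
    (B : Fin d → Set (Fin n))
    (hBmem : ∀ k, B k ∈ blocksL n L)
    (hBall : ∀ C ∈ blocksL n L, ∃! k, B k = C)
    (hBmono : StrictMono fun k => sInf {c : ℕ | ∃ v ∈ B k, (v : ℕ) = c})
    (a : Fin d → Fin n) (ha : ∀ k, a k ∈ B k ∧ ∀ j ∈ B k, precLE n L (a k) j)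
    (δ : Fin n → ℕ) (hδ : ∀ k, ∀ i ∈ B k, ∀ x ∈ L, x i - x (a k) = (δ i : ℝ)) :
    ∀ l k : Fin d, k ≠ l → ∀ t : ℕ, t ≤ sSup {c : ℕ | ∃ j ∈ B l, δ j = c} →
      ((B k).ncard = 1 ∧ (B l).ncard = 1) ∨ hyp d k l (t : ℝ) ∈ Atilde n d A B δ := by
  intro l k hkl t ht
  by_contra! hcon
  obtain ⟨hcard, hT⟩ := hcon
  obtain ⟨x, hx⟩ := hL.1
  have hNE : ∀ i ∈ B k, ∀ j ∈ B l, ∀ s : ℤ, s = t + δ i - δ j → hyp n i j (s : ℝ) ∉ A := by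
    intro i hi j hj s hs hmem
    refine hT ⟨k, l, hkl, i, hi, j, hj, s, hmem, ?_⟩
    congr 1
    rw [hs]; push_cast; ring
  have hsymm : ∀ i j, simL n L i j → simL n L j i := by
    rintro i j ⟨s, hs⟩
    refine ⟨-s, ?_⟩
    rw [hyp_swap] at hs
    push_cast; exact hs
  have htrans : ∀ i j r, simL n L i j → simL n L j r → simL n L i r := by
    rintro i j r ⟨s, hs⟩ ⟨s', hs'⟩
    refine ⟨s + s', fun y hy => ?_⟩
    have h1 : y i - y j = s := hs hy
    have h2 : y j - y r = s' := hs' hy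
    show y i - y r = _
    push_cast; linarith
  have hin : ∀ c, ∀ i ∈ B c, ∀ j, j ∈ B c ↔ simL n L i j := by
    intro c i hi j
    obtain ⟨v, hv⟩ := hBmem c
    rw [hv] at hi ⊢
    exact ⟨fun h => htrans _ _ _ (hsymm _ _ hi) h, fun h => htrans _ _ _ hi h⟩
  have hdisj : ∀ i ∈ B k, ∀ j ∈ B l, i ≠ j := by
    rintro i hi j hj rfl
    apply hkl
    have : B k = B l := by
      ext v; rw [hin k i hi, hin l i hj]
    obtain ⟨c, -, hc⟩ := hBall (B l) (hBmem l)
    rw [hc k this, hc l rfl]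
  have hδa : ∀ c, δ (a c) = 0 := by
    intro c
    have := hδ c (a c) (ha c).1 x hx
    simp at this
    exact_mod_cast this.symm
  -- edges of `A` inside a block
  have hedge : ∀ c, ∀ S : Set (Fin n), S ⊆ B c → ∀ i ∈ S, ∀ j ∈ B c, j ∉ S →
      ∃ i' ∈ S, ∃ j' ∈ B c, j' ∉ S ∧ ∃ s : ℤ, s = δ i' - δ j' ∧ hyp n i' j' (s : ℝ) ∈ A := by
    intro c S hS i hi j hj hjS
    obtain ⟨i', hi', j', hj', s, hsA, hsL⟩ :=
      crossing m n A hA L hL S i j hi hjS ((hin c i (hS hi) j).1 hj)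
    have hj'c : j' ∈ B c := (hin c i' (hS hi') j').2 ⟨s, hsL⟩
    refine ⟨i', hi', j', hj'c, hj', s, ?_, hsA⟩
    have h1 : x i' - x j' = s := hsL hx
    have h2 := hδ c i' (hS hi') x hx
    have h3 := hδ c j' hj'c x hx
    have : (s : ℝ) = δ i' - δ j' := by linarith
    exact_mod_cast this
  have hst' : ∀ i j r : Fin n, i ≠ j → j ≠ r → i ≠ r → ∀ u v w : ℤ, 0 ≤ u → 0 ≤ v → w = u + v →
      hyp n i j (u : ℝ) ∉ A → hyp n j r (v : ℝ) ∉ A → hyp n i r (w : ℝ) ∉ A := by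
    intro i j r h1 h2 h3 u v w hu hv hw hA1 hA2
    lift u to ℕ using hu
    lift v to ℕ using hv
    subst hw
    have := hst i j r h1 h2 h3 u v (by exact_mod_cast hA1) (by exact_mod_cast hA2)
    push_cast; exact this
  have hNE' : ∀ i ∈ B k, ∀ j ∈ B l, ∀ s : ℤ, s = δ j - t - δ i → hyp n j i (s : ℝ) ∉ A := by
    intro i hi j hj s hs
    rw [hyp_swap]
    have := hNE i hi j hj (-s) (by omega)
    push_cast at this; exact this
  have hl : ∀ i ∈ B l, ∀ j ∈ B l, i ≠ j → t ≤ δ i → δ j ≤ t → ∀ s : ℤ, s = δ i - δ j →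
      hyp n i j (s : ℝ) ∉ A := by
    intro i hi j hj hij h1 h2 s hs
    have hak := (ha k).1
    have h0 := hδa k
    exact hst' i (a k) j (hdisj _ hak _ hi).symm (hdisj _ hak _ hj) hij (δ i - t) (t - δ j) s
      (by omega) (by omega) (by omega)
      (hNE' _ hak _ hi _ (by omega)) (hNE _ hak _ hj _ (by omega))
  have ht0 : t = 0 := by
    by_contra ht0
    have hmem : sSup {c : ℕ | ∃ j ∈ B l, δ j = c} ∈ {c : ℕ | ∃ j ∈ B l, δ j = c} := by
      refine Nat.sSup_mem (s := {c : ℕ | ∃ j ∈ B l, δ j = c}) ⟨δ (a l), a l, (ha l).1, rfl⟩ ?_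
      have : {c : ℕ | ∃ j ∈ B l, δ j = c} = δ '' B l := rfl
      rw [this]
      exact ((Set.toFinite (B l)).image δ).bddAbove
    obtain ⟨j0, hj0, hj0e⟩ := hmem
    have h0 := hδa l
    obtain ⟨i', hi', j', hj', hjS, s, hs, hsA⟩ :=
      hedge l {j | j ∈ B l ∧ t ≤ δ j} (fun _ h => h.1) j0 ⟨hj0, by omega⟩ (a l) (ha l).1
        (fun h => by have := h.2; omega)
    have hlt : δ j' < t := by
      by_contra h
      exact hjS ⟨hj', by omega⟩
    have h2 : t ≤ δ i' := hi'.2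
    exact hl i' hi'.1 j' hj' (by rintro rfl; omega) h2 hlt.le s hs hsA
  subst ht0
  have hBl : B l = {a l} := by
    by_contra hne
    obtain ⟨j, hj, hja⟩ : ∃ j ∈ B l, j ≠ a l := by
      by_contra! h
      exact hne (Set.eq_singleton_iff_unique_mem.2 ⟨(ha l).1, h⟩)
    obtain ⟨i', hi', j', hj', hjS, s, hs, hsA⟩ :=
      hedge l {a l} (by simpa using (ha l).1) (a l) rfl j hj hja
    obtain rfl : i' = a l := hi'
    have h0 := hδa l
    rw [hyp_swap] at hsA
    refine hl j' hj' (a l) (ha l).1 hjS (by omega) (by omega) (-s) (by omega) ?_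
    push_cast; exact hsA
  have hBk : B k = {a k} := by
    by_contra hne
    obtain ⟨j, hj, hja⟩ : ∃ j ∈ B k, j ≠ a k := by
      by_contra! h
      exact hne (Set.eq_singleton_iff_unique_mem.2 ⟨(ha k).1, h⟩)
    obtain ⟨i', hi', j', hj', hjS, s, hs, hsA⟩ :=
      hedge k {a k} (by simpa using (ha k).1) (a k) rfl j hj hja
    obtain rfl : i' = a k := hi'
    have h0 := hδa l
    have h1 := hδa k
    rw [hyp_swap] at hsA
    refine hst' j' (a l) (a k) (hdisj _ hj' _ (ha l).1) (hdisj _ (ha k).1 _ (ha l).1).symm hjS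
      (δ j') 0 (-s) (by omega) le_rfl (by omega)
      (hNE _ hj' _ (ha l).1 _ (by push_cast; omega))
      (hNE' _ (ha k).1 _ (ha l).1 _ (by push_cast; omega)) ?_
    push_cast; exact hsA
  exact hcard (by rw [hBk]; simp) (by rw [hBl]; simp)

end Braid
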